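/- Fix an integer ℓ > 2 and a residue i with 0 ≤ i < ℓ. If λ is an (ℓ,0)-JM partition, then \hat f_i^{\hatφ_i(λ)} λ is an (ℓ,0)-JM partition and \hat e_i^{\hatε_i(λ)} λ is an (ℓ,0)-JM partition. -/

import Mathlib

noncomputable section

/-!
Common combinatorial definitions: partitions (English notation, rows indexed from 1),
Young diagrams, hooks, rim hooks, ladders, residues, crystal operators (classical and
ladder versions), locked boxes, regularization classes, dominance order.
-/

structure YPartition where
  part : ℕ → ℕ
  zero_at_zero : part 0 = 0
  antitone : ∀ i j : ℕ, 1 ≤ i → i ≤ j → part j ≤ part i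
  eventually_zero : ∃ N : ℕ, ∀ i : ℕ, N ≤ i → part i = 0

namespace YPartition

/-- The set of boxes of the Young diagram of `μ` (row, column), both indices ≥ 1. -/
def cells (μ : YPartition) : Set (ℕ × ℕ) :=
  {p | 1 ≤ p.1 ∧ 1 ≤ p.2 ∧ p.2 ≤ μ.part p.1}

/-- The length of column `b`: the number of rows containing a box in column `b`. -/
def colLen (μ : YPartition) (b : ℕ) : ℕ :=
  Nat.card {a : ℕ | 1 ≤ a ∧ b ≤ μ.part a}

/-- The arm of box `(a,b)`: boxes strictly to its right in its row. -/
def arm (μ : YPartition) (a b : ℕ) : ℕ := μ.part a - b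

/-- The leg of box `(a,b)`: boxes strictly below it in its column. -/
def leg (μ : YPartition) (a b : ℕ) : ℕ := μ.colLen b - a

/-- The hook length of the box `(a,b)`: arm + leg + 1. -/
def hook (μ : YPartition) (a b : ℕ) : ℕ := (μ.part a - b) + (μ.colLen b - a) + 1

/-- The number of boxes of `μ`. -/
def size (μ : YPartition) : ℕ := μ.cells.ncard

/-- The number of (nonzero) parts of `μ`. -/
def length (μ : YPartition) : ℕ := μ.colLen 1

/-- `μ` is an `(ℓ,0)`-JM partition: there are no boxes `(a,b)`, `(a,y)`, `(x,b)` with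
`ℓ ∣ hook (a,b)` while `ℓ` divides neither `hook (a,y)` nor `hook (x,b)`. -/
def IsJM (ℓ : ℕ) (μ : YPartition) : Prop :=
  ¬ ∃ a b y x : ℕ, (a, b) ∈ μ.cells ∧ (a, y) ∈ μ.cells ∧ (x, b) ∈ μ.cells ∧
    ℓ ∣ μ.hook a b ∧ ¬ ℓ ∣ μ.hook a y ∧ ¬ ℓ ∣ μ.hook x b

/-- Two boxes share an edge. -/
def BoxAdjacent (p q : ℕ × ℕ) : Prop :=
  (p.1 = q.1 ∧ (p.2 + 1 = q.2 ∨ q.2 + 1 = p.2)) ∨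
  (p.2 = q.2 ∧ (p.1 + 1 = q.1 ∨ q.1 + 1 = p.1))

/-- A set of boxes is connected (via shared edges, inside the set). -/
def SetConnected (S : Set (ℕ × ℕ)) : Prop :=
  ∀ p ∈ S, ∀ q ∈ S,
    Relation.ReflTransGen (fun x y => x ∈ S ∧ y ∈ S ∧ BoxAdjacent x y) p q

/-- `S` contains no 2 × 2 square of boxes. -/
def HasNoSquare (S : Set (ℕ × ℕ)) : Prop :=
  ¬ ∃ a b : ℕ, (a, b) ∈ S ∧ (a + 1, b) ∈ S ∧ (a, b + 1) ∈ S ∧ (a + 1, b + 1) ∈ S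

/-- `S` is a removable `ℓ`-rim hook of `μ`: a connected set of `ℓ` boxes of `μ` with no
2 × 2 square whose removal leaves the Young diagram of a partition. -/
def IsRimHook (ℓ : ℕ) (μ : YPartition) (S : Set (ℕ × ℕ)) : Prop :=
  S ⊆ μ.cells ∧ S.ncard = ℓ ∧ SetConnected S ∧ HasNoSquare S ∧
    ∃ ν : YPartition, ν.cells = μ.cells \ S

/-- `S` is contained in a single row. -/
def HorizontalHook (S : Set (ℕ × ℕ)) : Prop := ∃ a : ℕ, ∀ p ∈ S, p.1 = a

/-- `S` is contained in a single column. -/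
def VerticalHook (S : Set (ℕ × ℕ)) : Prop := ∃ b : ℕ, ∀ p ∈ S, p.2 = b

/-- Two sets of boxes are adjacent when some box of one shares an edge with a box of the other. -/
def SetsAdjacent (R S : Set (ℕ × ℕ)) : Prop := ∃ p ∈ R, ∃ q ∈ S, BoxAdjacent p q

/-- An `ℓ`-core: a partition with no removable `ℓ`-rim hook. -/
def IsCore (ℓ : ℕ) (μ : YPartition) : Prop := ¬ ∃ S : Set (ℕ × ℕ), IsRimHook ℓ μ S

/-- `p` and `q` lie on the same ladder: going down one column step the row increases
by `ℓ - 1`. -/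
def SameLadder (ℓ : ℕ) (p q : ℕ × ℕ) : Prop :=
  (q.1 : ℤ) - (p.1 : ℤ) = ((ℓ : ℤ) - 1) * ((p.2 : ℤ) - (q.2 : ℤ))

/-- The index of the ladder through `p`: the ladder through `(k,1)` has index `k`. -/
def ladderIdx (ℓ : ℕ) (p : ℕ × ℕ) : ℕ := p.1 + (ℓ - 1) * (p.2 - 1)

/-- The residue of position `(a,b)` is `b - a` mod `ℓ`. -/
def res (ℓ : ℕ) (p : ℕ × ℕ) : ℕ := (((p.2 : ℤ) - (p.1 : ℤ)) % (ℓ : ℤ)).toNat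

/-- `p` is a removable box of `μ`. -/
def Removable (μ : YPartition) (p : ℕ × ℕ) : Prop :=
  1 ≤ p.1 ∧ p.2 = μ.part p.1 ∧ μ.part (p.1 + 1) < p.2

/-- `p` is an addable box of `μ`. -/
def Addable (μ : YPartition) (p : ℕ × ℕ) : Prop :=
  1 ≤ p.1 ∧ p.2 = μ.part p.1 + 1 ∧ (p.1 = 1 ∨ p.2 ≤ μ.part (p.1 - 1))

/-- The removable `i`-boxes of `μ`. -/
def RemovableRes (ℓ i : ℕ) (μ : YPartition) : Set (ℕ × ℕ) :=
  {p | Removable μ p ∧ res ℓ p = i}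

/-- The addable `i`-boxes of `μ`. -/
def AddableRes (ℓ i : ℕ) (μ : YPartition) : Set (ℕ × ℕ) :=
  {p | Addable μ p ∧ res ℓ p = i}

/-- Ladder reading order (reflexive): ladders left to right, top to bottom within a ladder.
`LadderLE ℓ p q` means `p` is read before (or equal to) `q`. -/
def LadderLE (ℓ : ℕ) (p q : ℕ × ℕ) : Prop :=
  ladderIdx ℓ p < ladderIdx ℓ q ∨ (ladderIdx ℓ p = ladderIdx ℓ q ∧ p.1 ≤ q.1)

/-- Strict ladder reading order. -/
def LadderLT (ℓ : ℕ) (p q : ℕ × ℕ) : Prop :=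
  ladderIdx ℓ p < ladderIdx ℓ q ∨ (ladderIdx ℓ p = ladderIdx ℓ q ∧ p.1 < q.1)

/-- Classical reading order (reflexive): rows from bottom to top.
`RowLE p q` means `p` is read before (or equal to) `q`. -/
def RowLE (p q : ℕ × ℕ) : Prop := q.1 ≤ p.1

/-- Given a reading order `le`, a set `Rem` of `-` marks and `Add` of `+` marks, a `-` at `p`
survives the cancellation of adjacent `-+` pairs iff every interval of the reading word
starting at `p` contains strictly more `-`'s than `+`'s. -/
def NormalIn (le : ℕ × ℕ → ℕ × ℕ → Prop) (Rem Add : Set (ℕ × ℕ)) (p : ℕ × ℕ) : Prop :=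
  p ∈ Rem ∧ ∀ q ∈ Rem ∪ Add, le p q →
    (Add ∩ {s | le p s ∧ le s q}).ncard < (Rem ∩ {s | le p s ∧ le s q}).ncard

/-- A `+` at `q` survives the cancellation of adjacent `-+` pairs iff every interval of the
reading word ending at `q` contains strictly more `+`'s than `-`'s. -/
def ConormalIn (le : ℕ × ℕ → ℕ × ℕ → Prop) (Rem Add : Set (ℕ × ℕ)) (q : ℕ × ℕ) : Prop :=
  q ∈ Add ∧ ∀ p ∈ Rem ∪ Add, le p q →
    (Rem ∩ {s | le p s ∧ le s q}).ncard < (Add ∩ {s | le p s ∧ le s q}).ncard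

/-- Ladder normal `i`-box. -/
def LadderNormal (ℓ i : ℕ) (μ : YPartition) (p : ℕ × ℕ) : Prop :=
  NormalIn (LadderLE ℓ) (RemovableRes ℓ i μ) (AddableRes ℓ i μ) p

/-- Ladder conormal `i`-box. -/
def LadderConormal (ℓ i : ℕ) (μ : YPartition) (p : ℕ × ℕ) : Prop :=
  ConormalIn (LadderLE ℓ) (RemovableRes ℓ i μ) (AddableRes ℓ i μ) p

/-- Normal `i`-box (classical signature). -/
def ClassNormal (ℓ i : ℕ) (μ : YPartition) (p : ℕ × ℕ) : Prop :=
  NormalIn RowLE (RemovableRes ℓ i μ) (AddableRes ℓ i μ) p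

/-- Conormal `i`-box (classical signature). -/
def ClassConormal (ℓ i : ℕ) (μ : YPartition) (p : ℕ × ℕ) : Prop :=
  ConormalIn RowLE (RemovableRes ℓ i μ) (AddableRes ℓ i μ) p

/-- `ε̂_i(μ)`: number of ladder normal `i`-boxes. -/
def hatEps (ℓ i : ℕ) (μ : YPartition) : ℕ := {p | LadderNormal ℓ i μ p}.ncard

/-- `φ̂_i(μ)`: number of ladder conormal `i`-boxes. -/
def hatPhi (ℓ i : ℕ) (μ : YPartition) : ℕ := {p | LadderConormal ℓ i μ p}.ncard

/-- `ε_i(μ)`: number of normal `i`-boxes. -/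
def eps (ℓ i : ℕ) (μ : YPartition) : ℕ := {p | ClassNormal ℓ i μ p}.ncard

/-- `φ_i(μ)`: number of conormal `i`-boxes. -/
def phi (ℓ i : ℕ) (μ : YPartition) : ℕ := {p | ClassConormal ℓ i μ p}.ncard

/-- The ladder good `i`-box: the leftmost `-` of the reduced ladder `i`-signature. -/
def LadderGood (ℓ i : ℕ) (μ : YPartition) (p : ℕ × ℕ) : Prop :=
  LadderNormal ℓ i μ p ∧ ∀ q, LadderNormal ℓ i μ q → LadderLE ℓ p q

/-- The ladder cogood `i`-box: the rightmost `+` of the reduced ladder `i`-signature. -/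
def LadderCogood (ℓ i : ℕ) (μ : YPartition) (p : ℕ × ℕ) : Prop :=
  LadderConormal ℓ i μ p ∧ ∀ q, LadderConormal ℓ i μ q → LadderLE ℓ q p

/-- The good `i`-box (classical). -/
def ClassGood (ℓ i : ℕ) (μ : YPartition) (p : ℕ × ℕ) : Prop :=
  ClassNormal ℓ i μ p ∧ ∀ q, ClassNormal ℓ i μ q → RowLE p q

/-- The cogood `i`-box (classical). -/
def ClassCogood (ℓ i : ℕ) (μ : YPartition) (p : ℕ × ℕ) : Prop :=
  ClassConormal ℓ i μ p ∧ ∀ q, ClassConormal ℓ i μ q → RowLE q p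

/-- The ladder crystal operator `f̂_i` as a relation: `mu = f̂_i lam ≠ 0`. -/
def HatF (ℓ i : ℕ) (lam mu : YPartition) : Prop :=
  ∃ p, LadderCogood ℓ i lam p ∧ mu.cells = insert p lam.cells

/-- The ladder crystal operator `ê_i` as a relation: `mu = ê_i lam ≠ 0`. -/
def HatE (ℓ i : ℕ) (lam mu : YPartition) : Prop :=
  ∃ p, LadderGood ℓ i lam p ∧ mu.cells = lam.cells \ {p}

/-- The classical crystal operator `f̃_i` as a relation: `mu = f̃_i lam ≠ 0`. -/
def TildeF (ℓ i : ℕ) (lam mu : YPartition) : Prop :=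
  ∃ p, ClassCogood ℓ i lam p ∧ mu.cells = insert p lam.cells

/-- The classical crystal operator `ẽ_i` as a relation: `mu = ẽ_i lam ≠ 0`. -/
def TildeE (ℓ i : ℕ) (lam mu : YPartition) : Prop :=
  ∃ p, ClassGood ℓ i lam p ∧ mu.cells = lam.cells \ {p}

/-- `n`-fold composition of a relation. -/
def RelIter {α : Type} (r : α → α → Prop) : ℕ → α → α → Prop
  | 0 => fun a b => a = b
  | n + 1 => fun a b => ∃ c, r a c ∧ RelIter r n c b

/-- The empty partition. -/
def emptyP : YPartition where
  part := fun _ => 0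
  zero_at_zero := rfl
  antitone := fun _ _ _ _ => le_rfl
  eventually_zero := ⟨0, fun _ _ => rfl⟩

/-- `μ` is a node of the ladder crystal `B(Λ₀)^L`: it is obtained from the empty
partition by finitely many applications of the operators `f̂_i`, `0 ≤ i < ℓ`. -/
def LadderNode (ℓ : ℕ) (μ : YPartition) : Prop :=
  Relation.ReflTransGen (fun a b => ∃ i : ℕ, i < ℓ ∧ HatF ℓ i a b) emptyP μ

/-- The type I locking condition at `(a,b)`: every unoccupied position on the ladder of
`(a,b)` lying below it has an unoccupied position directly above it. -/
def LadderClear (ℓ : ℕ) (μ : YPartition) (a b : ℕ) : Prop :=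
  ∀ c d : ℕ, 1 ≤ c → 1 ≤ d → SameLadder ℓ (a, b) (c, d) → a < c →
    (c, d) ∉ μ.cells → (c - 1, d) ∉ μ.cells

/-- Locked boxes of `μ`. -/
inductive Locked (ℓ : ℕ) (μ : YPartition) : ℕ × ℕ → Prop where
  | typeI_top : ∀ b : ℕ, (1, b) ∈ μ.cells → LadderClear ℓ μ 1 b → Locked ℓ μ (1, b)
  | typeI_up : ∀ a b : ℕ, (a + 1, b) ∈ μ.cells → Locked ℓ μ (a, b) →
      LadderClear ℓ μ (a + 1) b → Locked ℓ μ (a + 1, b)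
  | typeII : ∀ a b b' : ℕ, (a, b) ∈ μ.cells → b < b' → Locked ℓ μ (a, b') → Locked ℓ μ (a, b)

/-- Number of boxes of `μ` on the `k`-th ladder. -/
def ladderCount (ℓ : ℕ) (μ : YPartition) (k : ℕ) : ℕ :=
  (μ.cells ∩ {p | ladderIdx ℓ p = k}).ncard

/-- `lam` and `mu` lie in the same regularization class: they have the same number of
boxes on every ladder. -/
def SameRegClass (ℓ : ℕ) (lam mu : YPartition) : Prop :=
  ∀ k : ℕ, ladderCount ℓ lam k = ladderCount ℓ mu k

/-- The boxes of `μ` are top-justified on each ladder. -/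
def TopJustified (ℓ : ℕ) (μ : YPartition) : Prop :=
  ∀ p ∈ μ.cells, ∀ q : ℕ × ℕ, 1 ≤ q.1 → 1 ≤ q.2 →
    ladderIdx ℓ q = ladderIdx ℓ p → q.1 < p.1 → q ∈ μ.cells

/-- `mu = R lam`: the regularization of `lam`, obtained by moving every box of `lam` to
the topmost unoccupied positions of its ladder. -/
def IsRegularization (ℓ : ℕ) (lam mu : YPartition) : Prop :=
  SameRegClass ℓ lam mu ∧ TopJustified ℓ mu

/-- Dominance order on partitions. -/
def DomLE (lam mu : YPartition) : Prop :=
  ∀ j : ℕ, ∑ i ∈ Finset.Icc 1 j, lam.part i ≤ ∑ i ∈ Finset.Icc 1 j, mu.part i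

/-- All (positive) positions on the `k`-th ladder. -/
def LadderPositions (ℓ k : ℕ) : Set (ℕ × ℕ) :=
  {p | 1 ≤ p.1 ∧ 1 ≤ p.2 ∧ ladderIdx ℓ p = k}

/-- The set of locked boxes of `μ`. -/
def lockedCells (ℓ : ℕ) (μ : YPartition) : Set (ℕ × ℕ) := {p | Locked ℓ μ p}

/-- The number of unlocked boxes of `μ` on the `k`-th ladder. -/
def unlockedCount (ℓ : ℕ) (μ : YPartition) (k : ℕ) : ℕ :=
  ((μ.cells ∩ LadderPositions ℓ k) \ lockedCells ℓ μ).ncard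

/-- The diagram `S μ`: locked boxes stay put, and on each ladder the unlocked boxes are
moved into the lowest positions of that ladder not occupied by locked boxes. -/
def SCells (ℓ : ℕ) (μ : YPartition) : Set (ℕ × ℕ) :=
  lockedCells ℓ μ ∪
    {p | 1 ≤ p.1 ∧ 1 ≤ p.2 ∧ p ∉ lockedCells ℓ μ ∧
      ((LadderPositions ℓ (ladderIdx ℓ p) ∩ {q | p.1 < q.1}) \ lockedCells ℓ μ).ncard
        < unlockedCount ℓ μ (ladderIdx ℓ p)}

/-- `μ` is `ℓ`-regular: no part occurs `ℓ` or more times. -/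
def IsRegular (ℓ : ℕ) (μ : YPartition) : Prop :=
  ∀ a : ℕ, 1 ≤ a → 0 < μ.part (a + (ℓ - 1)) → μ.part (a + (ℓ - 1)) < μ.part a

/-- Removal of a single horizontal or vertical `ℓ`-rim hook. -/
def RemoveHV (ℓ : ℕ) (lam mu : YPartition) : Prop :=
  ∃ S : Set (ℕ × ℕ), IsRimHook ℓ lam S ∧ (HorizontalHook S ∨ VerticalHook S) ∧
    mu.cells = lam.cells \ S

/-- Condition (1): every removable `ℓ`-rim hook is horizontal or vertical. -/
def Cond1 (ℓ : ℕ) (μ : YPartition) : Prop :=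
  ∀ S : Set (ℕ × ℕ), IsRimHook ℓ μ S → HorizontalHook S ∨ VerticalHook S

/-- Condition (2): no vertical (resp. horizontal) `ℓ`-rim hook `R` of `μ` together with an
adjacent horizontal (resp. vertical) `ℓ`-rim hook `S` of `μ \ R` . -/
def Cond2 (ℓ : ℕ) (μ : YPartition) : Prop :=
  ¬ ∃ (R S : Set (ℕ × ℕ)) (ν : YPartition), IsRimHook ℓ μ R ∧ ν.cells = μ.cells \ R ∧
    IsRimHook ℓ ν S ∧ SetsAdjacent R S ∧
    ((VerticalHook R ∧ HorizontalHook S) ∨ (HorizontalHook R ∧ VerticalHook S))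

/-- A generalized `ℓ`-partition: conditions (1) and (2) hold after removing any sequence of
horizontal and vertical `ℓ`-rim hooks (including the empty sequence). -/
def IsGenLPartition (ℓ : ℕ) (lam : YPartition) : Prop :=
  ∀ mu : YPartition, Relation.ReflTransGen (RemoveHV ℓ) lam mu → Cond1 ℓ mu ∧ Cond2 ℓ mu

/-- The `t`-th row (from the top) of the bottom block of the decomposition
`(μ, r, s, ρ, σ)`: the number of values `v ∈ [1, s+1]` whose column block still reaches
row `t`; column block `v` consists of `σ_v·ℓ + (s+1−v)(ℓ−1)` rows of length `≥ v`. -/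
def bottomPart (ℓ s : ℕ) (σ : YPartition) (t : ℕ) : ℕ :=
  ((Finset.Icc 1 (s + 1)).filter fun v => t ≤ σ.part v * ℓ + (s + 1 - v) * (ℓ - 1)).card

/-- The `i`-th part of the partition corresponding to the data `(μ, r, s, ρ, σ)`. -/
def decompPart (ℓ : ℕ) (mu : YPartition) (r s : ℕ) (ρ σ : YPartition) (i : ℕ) : ℕ :=
  if i = 0 then 0
  else if i ≤ r + 1 then s + mu.part 1 + (r + 1 - i) * (ℓ - 1) + ρ.part i * ℓ
  else if i ≤ r + max mu.length 1 then s + mu.part (i - r)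
  else bottomPart ℓ s σ (i - (r + max mu.length 1))

/-- Admissibility of the decomposition data `(μ, r, s, ρ, σ)`. -/
def GoodData (ℓ : ℕ) (mu : YPartition) (r s : ℕ) (ρ σ : YPartition) : Prop :=
  IsCore ℓ mu ∧ mu.part 1 < mu.part 2 + (ℓ - 1) ∧ mu.colLen 1 < mu.colLen 2 + (ℓ - 1) ∧
  ρ.length ≤ r + 1 ∧ σ.length ≤ s + 1 ∧
  (mu.cells = ∅ → ρ.part (r + 1) = 0 ∨ σ.part (s + 1) = 0)

/-- `lam ≈ (μ, r, s, ρ, σ)`. -/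
def Decomposes (ℓ : ℕ) (lam mu : YPartition) (r s : ℕ) (ρ σ : YPartition) : Prop :=
  ∀ i : ℕ, lam.part i = decompPart ℓ mu r s ρ σ i

/-- Removal of a single `ℓ`-rim hook. -/
def RemoveHook (ℓ : ℕ) (lam mu : YPartition) : Prop :=
  ∃ S : Set (ℕ × ℕ), IsRimHook ℓ lam S ∧ mu.cells = lam.cells \ S

/-- `lam` has `ℓ`-core `nu` and `ℓ`-weight `w`. -/
def HasCoreAndWeight (ℓ : ℕ) (lam nu : YPartition) (w : ℕ) : Prop :=
  IsCore ℓ nu ∧ RelIter (RemoveHook ℓ) w lam nu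

/-- An L-partition. -/
def IsLPartition (ℓ : ℕ) (lam : YPartition) : Prop :=
  ¬ ∃ p : ℕ × ℕ, p ∈ lam.cells ∧ ℓ ∣ lam.hook p.1 p.2 ∧
    (lam.arm p.1 p.2 < (ℓ - 1) * lam.leg p.1 p.2 ∨
     lam.leg p.1 p.2 < (ℓ - 1) * lam.arm p.1 p.2)

end YPartition

open YPartition

/-! ### Bead sets -/

/-- The bead of row `a`. -/
def beta (μ : YPartition) (a : ℕ) : ℤ := (μ.part a : ℤ) - a

/-- The bead set. -/
def bd (μ : YPartition) : Set ℤ := {z | ∃ a, 1 ≤ a ∧ beta μ a = z}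

/-- The gap of column `b`. -/
def gam (μ : YPartition) (b : ℕ) : ℤ := (b : ℤ) - 1 - μ.colLen b

theorem exists_height (μ : YPartition) (b : ℕ) (hb : 1 ≤ b) :
    ∃ k, ∀ a, 1 ≤ a → (b ≤ μ.part a ↔ a ≤ k) := by
  classical
  obtain ⟨N, hN⟩ := μ.eventually_zero
  have hex : ∃ k, μ.part (k + 1) < b := ⟨N, by rw [hN (N + 1) (by omega)]; omega⟩
  refine ⟨Nat.find hex, fun a ha => ?_⟩
  have h1 := Nat.find_spec hex
  constructor
  · intro h
    by_contra hlt
    have := μ.antitone (Nat.find hex + 1) a (by omega) (by omega)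
    omega
  · intro h
    have := Nat.find_min hex (m := a - 1) (by omega)
    rw [Nat.sub_add_cancel ha] at this
    omega

theorem colLen_eq (μ : YPartition) (b k : ℕ)
    (h : ∀ a, 1 ≤ a → (b ≤ μ.part a ↔ a ≤ k)) : μ.colLen b = k := by
  have : {a : ℕ | 1 ≤ a ∧ b ≤ μ.part a} = ((Finset.Icc 1 k : Finset ℕ) : Set ℕ) := by
    ext a
    simp only [Set.mem_ofPred_eq, Finset.coe_Icc, Set.mem_Icc]
    constructor
    · rintro ⟨h1, h2⟩; exact ⟨h1, (h a h1).1 h2⟩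
    · rintro ⟨h1, h2⟩; exact ⟨h1, (h a h1).2 h2⟩
  unfold colLen
  rw [this, Nat.card_coe_set_eq, Set.ncard_coe_finset]
  simp

theorem le_colLen (μ : YPartition) {a b : ℕ} (ha : 1 ≤ a) (hb : 1 ≤ b) :
    a ≤ μ.colLen b ↔ b ≤ μ.part a := by
  obtain ⟨k, hk⟩ := exists_height μ b hb
  rw [colLen_eq μ b k hk]
  exact (hk a ha).symm

theorem beta_lt (μ : YPartition) {a c : ℕ} (ha : 1 ≤ a) (h : a < c) : beta μ c < beta μ a := by
  have := μ.antitone a c ha h.le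
  unfold beta
  omega

theorem beta_le_iff (μ : YPartition) {a c : ℕ} (ha : 1 ≤ a) (hc : 1 ≤ c) :
    beta μ c < beta μ a ↔ a < c := by
  constructor
  · intro h
    by_contra hn
    rcases Nat.lt_or_ge c a with h1 | h1
    · have := beta_lt μ hc h1
      omega
    · have : a = c := by omega
      subst this
      omega
  · exact beta_lt μ ha

theorem beta_inj (μ : YPartition) {a c : ℕ} (ha : 1 ≤ a) (hc : 1 ≤ c)
    (h : beta μ a = beta μ c) : a = c := by
  rcases Nat.lt_trichotomy a c with h1 | h1 | h1
  · have := beta_lt μ ha h1; omega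
  · exact h1
  · have := beta_lt μ hc h1; omega

theorem gam_lt_beta (μ : YPartition) {a b : ℕ} (ha : 1 ≤ a) (hb : 1 ≤ b) :
    (b ≤ μ.part a → gam μ b < beta μ a) ∧ (μ.part a < b → beta μ a < gam μ b) := by
  have h := le_colLen μ ha hb
  unfold gam beta
  constructor
  · intro h1
    have := h.2 h1
    omega
  · intro h1
    have : ¬ a ≤ μ.colLen b := fun h2 => by have := h.1 h2; omega
    omega

theorem hook_eq (μ : YPartition) {a b : ℕ} (h : (a, b) ∈ μ.cells) :
    (μ.hook a b : ℤ) = beta μ a - gam μ b := by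
  obtain ⟨ha, hb, hab⟩ := h
  simp only at ha hb hab
  have := (le_colLen μ ha hb).2 hab
  unfold hook gam beta
  omega

theorem gam_not_mem (μ : YPartition) {b : ℕ} (hb : 1 ≤ b) : gam μ b ∉ bd μ := by
  rintro ⟨a, ha, h⟩
  have := gam_lt_beta μ ha hb
  rcases Nat.lt_or_ge (μ.part a) b with h1 | h1
  · have := this.2 h1; omega
  · have := this.1 h1; omega

theorem exists_gam (μ : YPartition) {z : ℤ} (hz : z ∉ bd μ) : ∃ b, 1 ≤ b ∧ gam μ b = z := by
  classical
  have hex : ∃ k : ℕ, beta μ (k + 1) < z := by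
    obtain ⟨N, hN⟩ := μ.eventually_zero
    refine ⟨N + z.natAbs, ?_⟩
    unfold beta
    rw [hN _ (by omega)]
    omega
  have h1 := Nat.find_spec hex
  set k := Nat.find hex with hk
  have h2 : ∀ a, 1 ≤ a → (a ≤ k ↔ z < beta μ a) := by
    intro a ha
    constructor
    · intro h
      have h3 := Nat.find_min hex (m := a - 1) (by omega)
      rw [Nat.sub_add_cancel ha] at h3
      have : beta μ a ≠ z := fun h4 => hz ⟨a, ha, h4⟩
      omega
    · intro h
      by_contra h3
      rcases Nat.lt_or_ge (k + 1) a with h4 | h4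
      · have := beta_lt μ (a := k + 1) (by omega) h4
        omega
      · have : a = k + 1 := by omega
        rw [this] at h
        omega
  have h0 : 0 < z + 1 + k := by unfold beta at h1; omega
  refine ⟨(z + 1 + k).toNat, by omega, ?_⟩
  have : μ.colLen (z + 1 + k).toNat = k := by
    apply colLen_eq
    intro a ha
    constructor
    · intro h
      by_contra h3
      have h4 := μ.antitone (k + 1) a (by omega) (by omega)
      unfold beta at h1
      omega
    · intro h
      have hk1 : 1 ≤ k := by omega
      have h4 := μ.antitone a k ha h
      have h5 := (h2 k hk1).1 le_rfl
      unfold beta at h5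
      omega
  unfold gam
  rw [this]
  omega

/-- The JM condition on bead sets. -/
def JMB (ℓ : ℕ) (B : Set ℤ) : Prop :=
  ∀ x y y' x' : ℤ, x ∈ B → y ∉ B → y' ∉ B → x' ∈ B → y < x → y' < x → y < x' →
    (ℓ : ℤ) ∣ x - y → (ℓ : ℤ) ∣ x - y' ∨ (ℓ : ℤ) ∣ x' - y

theorem mem_cells_of_lt (μ : YPartition) {a b : ℕ} (ha : 1 ≤ a) (hb : 1 ≤ b)
    (h : gam μ b < beta μ a) : (a, b) ∈ μ.cells := by
  refine ⟨ha, hb, ?_⟩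
  by_contra h1
  have := (gam_lt_beta μ ha hb).2 (by simpa using h1)
  omega

theorem lt_of_mem_cells (μ : YPartition) {a b : ℕ} (h : (a, b) ∈ μ.cells) :
    gam μ b < beta μ a := (gam_lt_beta μ h.1 h.2.1).1 h.2.2

theorem isJM_iff (ℓ : ℕ) (μ : YPartition) : IsJM ℓ μ ↔ JMB ℓ (bd μ) := by
  constructor
  · rintro h x y y' x' ⟨a, ha, rfl⟩ hy hy' ⟨c, hc, rfl⟩ h1 h2 h3 hd
    obtain ⟨b, hb, rfl⟩ := exists_gam μ hy
    obtain ⟨b', hb', rfl⟩ := exists_gam μ hy'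
    have m1 := mem_cells_of_lt μ ha hb h1
    have m2 := mem_cells_of_lt μ ha hb' h2
    have m3 := mem_cells_of_lt μ hc hb h3
    by_contra hn
    push Not at hn
    apply h
    refine ⟨a, b, b', c, m1, m2, m3, ?_, ?_, ?_⟩
    · rw [← Int.natCast_dvd_natCast, hook_eq μ m1]; exact hd
    · rw [← Int.natCast_dvd_natCast, hook_eq μ m2]; exact hn.1
    · rw [← Int.natCast_dvd_natCast, hook_eq μ m3]; exact hn.2
  · rintro h ⟨a, b, b', c, m1, m2, m3, d1, d2, d3⟩
    rw [← Int.natCast_dvd_natCast, hook_eq μ m1] at d1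
    rw [← Int.natCast_dvd_natCast, hook_eq μ m2] at d2
    rw [← Int.natCast_dvd_natCast, hook_eq μ m3] at d3
    have := h (beta μ a) (gam μ b) (gam μ b') (beta μ c) ⟨a, m1.1, rfl⟩ (gam_not_mem μ m1.2.1)
      (gam_not_mem μ m2.2.1) ⟨c, m3.1, rfl⟩ (lt_of_mem_cells μ m1) (lt_of_mem_cells μ m2)
      (lt_of_mem_cells μ m3) d1
    tauto

/-- Sorting the pairs `(z, z+1)`, `z + 1 ≡ i`, upwards. -/
def UpOf (ℓ : ℕ) (i : ℤ) (B B' : Set ℤ) : Prop :=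
  (∀ z, (ℓ : ℤ) ∣ z - i → (z ∈ B' ↔ z ∈ B ∨ z - 1 ∈ B)) ∧
  (∀ z, (ℓ : ℤ) ∣ z + 1 - i → (z ∈ B' ↔ z ∈ B ∧ z + 1 ∈ B)) ∧
  (∀ z, ¬ (ℓ : ℤ) ∣ z - i → ¬ (ℓ : ℤ) ∣ z + 1 - i → (z ∈ B' ↔ z ∈ B))

/-- Sorting the pairs `(z, z+1)`, `z + 1 ≡ i`, downwards. -/
def DownOf (ℓ : ℕ) (i : ℤ) (B B' : Set ℤ) : Prop :=
  (∀ z, (ℓ : ℤ) ∣ z - i → (z ∈ B' ↔ z ∈ B ∧ z - 1 ∈ B)) ∧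
  (∀ z, (ℓ : ℤ) ∣ z + 1 - i → (z ∈ B' ↔ z ∈ B ∨ z + 1 ∈ B)) ∧
  (∀ z, ¬ (ℓ : ℤ) ∣ z - i → ¬ (ℓ : ℤ) ∣ z + 1 - i → (z ∈ B' ↔ z ∈ B))

theorem dv_one {ℓ : ℕ} (hℓ : 2 < ℓ) {a b : ℤ} (h : (ℓ : ℤ) ∣ a) (h' : (ℓ : ℤ) ∣ b) :
    a - b ≠ 1 ∧ a - b ≠ -1 := by
  have h2 : (ℓ : ℤ) ∣ a - b := dvd_sub h h'
  constructor <;> intro h3 <;> rw [h3] at h2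
  · have := Int.le_of_dvd (by norm_num) h2; omega
  · have := Int.le_of_dvd (by norm_num) ((dvd_neg).2 h2); omega

theorem dv_iff {ℓ : ℕ} {a b : ℤ} (h : (ℓ : ℤ) ∣ a - b) (c : ℤ) :
    (ℓ : ℤ) ∣ a - c ↔ (ℓ : ℤ) ∣ b - c := by
  constructor
  · intro h'; have := dvd_sub h' h; ring_nf at this ⊢; exact this
  · intro h'; have := dvd_add h' h; ring_nf at this ⊢; exact this

/-- two congruent integers with `y < x` differ by at least `ℓ`. -/
theorem dv_le {ℓ : ℕ} {x y : ℤ} (h : (ℓ : ℤ) ∣ x - y) (hlt : y < x) : y + ℓ ≤ x := by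
  have := Int.le_of_dvd (by omega) h
  omega

section runner
variable {ℓ : ℕ} {i : ℤ}

theorem cA {a b : ℤ} (h : (ℓ : ℤ) ∣ a - i) (h' : ¬ (ℓ : ℤ) ∣ b - i) : ¬ (ℓ : ℤ) ∣ a - b := by
  intro h2
  exact h' ((dv_iff h2 i).1 h)

theorem cB {a b : ℤ} (h : ¬ (ℓ : ℤ) ∣ a - i) (h' : (ℓ : ℤ) ∣ b - i) : ¬ (ℓ : ℤ) ∣ a - b := by
  intro h2
  exact h ((dv_iff h2 i).2 h')

theorem cC (hℓ : 2 < ℓ) {a : ℤ} (h : (ℓ : ℤ) ∣ a - i) :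
    ¬ (ℓ : ℤ) ∣ a + 1 - i ∧ ¬ (ℓ : ℤ) ∣ a - 1 - i := by
  constructor <;> intro h2
  · have := dv_one hℓ h h2; omega
  · have := dv_one hℓ h h2; omega

theorem cD {a b : ℤ} (h : (ℓ : ℤ) ∣ a - i) (h' : (ℓ : ℤ) ∣ b - i) : (ℓ : ℤ) ∣ a - b := by
  rw [dv_iff (b := i) h]
  have := (dvd_neg).2 h'
  simpa using this

theorem cE (hℓ : 2 < ℓ) {a : ℤ} : ¬ (ℓ : ℤ) ∣ a - (a + 1) ∧ ¬ (ℓ : ℤ) ∣ a - (a - 1) ∧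
    ¬ (ℓ : ℤ) ∣ a + 1 - a ∧ ¬ (ℓ : ℤ) ∣ a - 1 - a := by
  have z : (ℓ : ℤ) ∣ 0 := dvd_zero _
  refine ⟨fun h => ?_, fun h => ?_, fun h => ?_, fun h => ?_⟩ <;>
  · have := dv_one hℓ z h; omega

theorem JMB.false {B : Set ℤ} (h : JMB ℓ B) {x y y' x' : ℤ} (hx : x ∈ B) (hy : y ∉ B)
    (hy' : y' ∉ B) (hx' : x' ∈ B) (h1 : y < x) (h2 : y' < x) (h3 : y < x')
    (d : (ℓ : ℤ) ∣ x - y) (n1 : ¬ (ℓ : ℤ) ∣ x - y') (n2 : ¬ (ℓ : ℤ) ∣ x' - y) : False := by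
  rcases h x y y' x' hx hy hy' hx' h1 h2 h3 d with h | h
  · exact n1 h
  · exact n2 h

theorem JMB.up (hℓ : 2 < ℓ) {B B' : Set ℤ} (h : JMB ℓ B) (hu : UpOf ℓ i B B') : JMB ℓ B' := by
  obtain ⟨u1, u2, u3⟩ := hu
  intro x y y' x' hx hy hy' hx' h1 h2 h3 d
  by_contra hn
  push Not at hn
  obtain ⟨n1, n2⟩ := hn
  have hle := dv_le d h1
  have d1 : (ℓ : ℤ) ∣ x + 1 - (y + 1) := by ring_nf at d ⊢; exact d
  have dm : (ℓ : ℤ) ∣ x - 1 - (y - 1) := by ring_nf at d ⊢; exact d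
  by_cases p : (ℓ : ℤ) ∣ x - i
  · -- runner `i`
    have py : (ℓ : ℤ) ∣ y - i := (dv_iff d i).1 p
    have hy2 : ¬ (y ∈ B ∨ y - 1 ∈ B) := fun hh => hy ((u1 y py).2 hh)
    push Not at hy2
    obtain ⟨g1, g2⟩ := hy2
    have px' : ¬ (ℓ : ℤ) ∣ x' - i := fun hh => n2 (cD hh py)
    have hxB' : x' ∈ B := by
      by_cases q : (ℓ : ℤ) ∣ x' + 1 - i
      · exact ((u2 x' q).1 hx').1
      · exact (u3 x' px' q).1 hx'
    by_cases hxB : x ∈ B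
    · refine h.false hxB g1 g2 hxB' h1 (by omega) h3 d ?_ n2
      exact cA p (cC hℓ py).2
    · have hx1 : x - 1 ∈ B := by
        rcases (u1 x p).1 hx with hh | hh
        · exact absurd hh hxB
        · exact hh
      by_cases q : (ℓ : ℤ) ∣ x' + 1 - i
      · refine h.false hx1 g2 g1 ((u2 x' q).1 hx').2 (by omega) (by omega) (by omega) dm ?_ ?_
        · exact cB (cC hℓ p).2 py
        · exact cA q (cC hℓ py).2
      · refine h.false hx1 g2 g1 hxB' (by omega) (by omega) (by omega) dm ?_ ?_
        · exact cB (cC hℓ p).2 py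
        · intro hh
          apply q
          have : (ℓ : ℤ) ∣ (x' + 1) - y := by ring_nf at hh ⊢; exact hh
          exact (dv_iff this i).2 py
  by_cases p1 : (ℓ : ℤ) ∣ x + 1 - i
  · -- runner `i - 1`
    have py : (ℓ : ℤ) ∣ y + 1 - i := (dv_iff d1 i).1 p1
    obtain ⟨g1, g2⟩ := (u2 x p1).1 hx
    have py' : ¬ (ℓ : ℤ) ∣ y' + 1 - i := by
      intro hh
      apply n1
      have := cD p1 hh
      ring_nf at this ⊢; exact this
    have hyB' : y' ∉ B := by
      by_cases q : (ℓ : ℤ) ∣ y' - i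
      · exact fun hh => hy' ((u1 y' q).2 (Or.inl hh))
      · exact fun hh => hy' ((u3 y' q py').2 hh)
    by_cases hyB : y ∈ B
    · have hy1 : y + 1 ∉ B := fun hh => hy ((u2 y py).2 ⟨hyB, hh⟩)
      by_cases q : (ℓ : ℤ) ∣ y' - i
      · have hq : y' - 1 ∉ B := fun hh => hy' ((u1 y' q).2 (Or.inr hh))
        refine h.false g2 hy1 hq g1 (by omega) (by omega) (by omega) d1 ?_ ?_
        · exact cA p1 (cC hℓ q).2
        · exact cB p py
      · refine h.false g2 hy1 hyB' g1 (by omega) (by omega) (by omega) d1 ?_ ?_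
        · exact cA p1 q
        · exact cB p py
    · refine h.false g1 hyB hyB' g2 (by omega) (by omega) (by omega) d n1 ?_
      apply cA p1
      intro hh
      exact (cC hℓ hh).1 py
  · -- other runners
    have py : ¬ (ℓ : ℤ) ∣ y - i := fun hh => p ((dv_iff d i).2 hh)
    have py1 : ¬ (ℓ : ℤ) ∣ y + 1 - i := fun hh => p1 ((dv_iff d1 i).2 hh)
    have hxB := (u3 x p p1).1 hx
    have hyB : y ∉ B := fun hh => hy ((u3 y py py1).2 hh)
    have e1 : ∃ y'', y'' ∉ B ∧ y'' < x ∧ ¬ (ℓ : ℤ) ∣ x - y'' := by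
      by_cases q : (ℓ : ℤ) ∣ y' - i
      · exact ⟨y', fun hh => hy' ((u1 y' q).2 (Or.inl hh)), h2, n1⟩
      by_cases q1 : (ℓ : ℤ) ∣ y' + 1 - i
      · by_cases hB : y' ∈ B
        · refine ⟨y' + 1, fun hh => hy' ((u2 y' q1).2 ⟨hB, hh⟩), ?_, cB p q1⟩
          have : y' + 1 ≠ x := by rintro rfl; exact p q1
          omega
        · exact ⟨y', hB, h2, n1⟩
      · exact ⟨y', fun hh => hy' ((u3 y' q q1).2 hh), h2, n1⟩
    have e2 : ∃ x'', x'' ∈ B ∧ y < x'' ∧ ¬ (ℓ : ℤ) ∣ x'' - y := by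
      by_cases q : (ℓ : ℤ) ∣ x' - i
      · rcases (u1 x' q).1 hx' with hB | hB
        · exact ⟨x', hB, h3, n2⟩
        · refine ⟨x' - 1, hB, ?_, ?_⟩
          · have : x' - 1 ≠ y := by
              rintro rfl
              exact py1 (by simpa using q)
            omega
          · intro hh
            have hh2 : (ℓ : ℤ) ∣ x' - (y + 1) := by ring_nf at hh ⊢; exact hh
            exact cA q py1 hh2
      by_cases q1 : (ℓ : ℤ) ∣ x' + 1 - i
      · exact ⟨x', ((u2 x' q1).1 hx').1, h3, n2⟩
      · exact ⟨x', (u3 x' q q1).1 hx', h3, n2⟩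
    obtain ⟨y'', a1, a2, a3⟩ := e1
    obtain ⟨x'', b1, b2, b3⟩ := e2
    exact h.false hxB hyB a1 b1 h1 a2 b2 d a3 b3

theorem JMB.down (hℓ : 2 < ℓ) {B B' : Set ℤ} (h : JMB ℓ B) (hu : DownOf ℓ i B B') :
    JMB ℓ B' := by
  obtain ⟨u1, u2, u3⟩ := hu
  intro x y y' x' hx hy hy' hx' h1 h2 h3 d
  by_contra hn
  push Not at hn
  obtain ⟨n1, n2⟩ := hn
  have hle := dv_le d h1
  have d1 : (ℓ : ℤ) ∣ x + 1 - (y + 1) := by ring_nf at d ⊢; exact d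
  have dm : (ℓ : ℤ) ∣ x - 1 - (y - 1) := by ring_nf at d ⊢; exact d
  by_cases p : (ℓ : ℤ) ∣ x - i
  · -- runner `i`
    have py : (ℓ : ℤ) ∣ y - i := (dv_iff d i).1 p
    obtain ⟨g1, g2⟩ := (u1 x p).1 hx
    have py' : ¬ (ℓ : ℤ) ∣ y' - i := fun hh => n1 (cD p hh)
    have hyB' : y' ∉ B := by
      by_cases q : (ℓ : ℤ) ∣ y' + 1 - i
      · exact fun hh => hy' ((u2 y' q).2 (Or.inl hh))
      · exact fun hh => hy' ((u3 y' py' q).2 hh)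
    by_cases hyB : y ∈ B
    · have hy1 : y - 1 ∉ B := fun hh => hy ((u1 y py).2 ⟨hyB, hh⟩)
      have hne : y' ≠ x - 1 := by rintro rfl; exact hyB' g2
      by_cases q : (ℓ : ℤ) ∣ y' + 1 - i
      · have hq : y' + 1 ∉ B := fun hh => hy' ((u2 y' q).2 (Or.inr hh))
        have hne2 : y' + 1 ≠ x - 1 := by
          intro hh
          rw [hh] at q
          exact (cC hℓ p).2 q
        refine h.false g2 hy1 hq g1 (by omega) (by omega) (by omega) dm ?_ ?_
        · exact cB (cC hℓ p).2 q
        · exact cA p (cC hℓ py).2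
      · refine h.false g2 hy1 hyB' g1 (by omega) (by omega) (by omega) dm ?_ ?_
        · intro hh
          have hh2 : (ℓ : ℤ) ∣ x - (y' + 1) := by ring_nf at hh ⊢; exact hh
          exact cA p q hh2
        · exact cA p (cC hℓ py).2
    · refine h.false g1 hyB hyB' g2 (by omega) (by omega) (by omega) d n1 ?_
      exact cB (cC hℓ p).2 py
  by_cases p1 : (ℓ : ℤ) ∣ x + 1 - i
  · -- runner `i - 1`
    have py : (ℓ : ℤ) ∣ y + 1 - i := (dv_iff d1 i).1 p1
    have py0 : ¬ (ℓ : ℤ) ∣ y - i := fun hh => (cC hℓ hh).1 py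
    have hy2 : ¬ (y ∈ B ∨ y + 1 ∈ B) := fun hh => hy ((u2 y py).2 hh)
    push Not at hy2
    obtain ⟨g1, g2⟩ := hy2
    have px' : ¬ (ℓ : ℤ) ∣ x' + 1 - i := by
      intro hh
      apply n2
      have := cD hh py
      ring_nf at this ⊢; exact this
    have hxB' : x' ∈ B := by
      by_cases q : (ℓ : ℤ) ∣ x' - i
      · exact ((u1 x' q).1 hx').1
      · exact (u3 x' q px').1 hx'
    have hne : x' ≠ y + 1 := by rintro rfl; exact g2 hxB'
    by_cases hxB : x ∈ B
    · refine h.false hxB g1 g2 hxB' h1 (by omega) h3 d ?_ n2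
      exact cB p py
    · have hx1 : x + 1 ∈ B := by
        rcases (u2 x p1).1 hx with hh | hh
        · exact absurd hh hxB
        · exact hh
      by_cases q : (ℓ : ℤ) ∣ x' - i
      · have hq := ((u1 x' q).1 hx').2
        have hne2 : x' - 1 ≠ y + 1 := by rintro hh; exact g2 (hh ▸ hq)
        refine h.false hx1 g2 g1 hq (by omega) (by omega) (by omega) d1 ?_ ?_
        · exact cA p1 py0
        · exact cB (cC hℓ q).2 py
      · refine h.false hx1 g2 g1 hxB' (by omega) (by omega) (by omega) d1 ?_ ?_
        · exact cA p1 py0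
        · exact cB q py
  · -- other runners
    have py : ¬ (ℓ : ℤ) ∣ y - i := fun hh => p ((dv_iff d i).2 hh)
    have py1 : ¬ (ℓ : ℤ) ∣ y + 1 - i := fun hh => p1 ((dv_iff d1 i).2 hh)
    have hxB := (u3 x p p1).1 hx
    have hyB : y ∉ B := fun hh => hy ((u3 y py py1).2 hh)
    have e1 : ∃ y'', y'' ∉ B ∧ y'' < x ∧ ¬ (ℓ : ℤ) ∣ x - y'' := by
      by_cases q : (ℓ : ℤ) ∣ y' - i
      · by_cases hB : y' ∈ B
        · refine ⟨y' - 1, fun hh => hy' ((u1 y' q).2 ⟨hB, hh⟩), by omega, ?_⟩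
          intro hh
          have hh2 : (ℓ : ℤ) ∣ x + 1 - y' := by ring_nf at hh ⊢; exact hh
          exact cB p1 q hh2
        · exact ⟨y', hB, h2, n1⟩
      by_cases q1 : (ℓ : ℤ) ∣ y' + 1 - i
      · exact ⟨y', fun hh => hy' ((u2 y' q1).2 (Or.inl hh)), h2, n1⟩
      · exact ⟨y', fun hh => hy' ((u3 y' q q1).2 hh), h2, n1⟩
    have e2 : ∃ x'', x'' ∈ B ∧ y < x'' ∧ ¬ (ℓ : ℤ) ∣ x'' - y := by
      by_cases q : (ℓ : ℤ) ∣ x' - i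
      · exact ⟨x', ((u1 x' q).1 hx').1, h3, n2⟩
      by_cases q1 : (ℓ : ℤ) ∣ x' + 1 - i
      · rcases (u2 x' q1).1 hx' with hB | hB
        · exact ⟨x', hB, h3, n2⟩
        · exact ⟨x' + 1, hB, by omega, cA q1 py⟩
      · exact ⟨x', (u3 x' q q1).1 hx', h3, n2⟩
    obtain ⟨y'', a1, a2, a3⟩ := e1
    obtain ⟨x'', b1, b2, b3⟩ := e2
    exact h.false hxB hyB a1 b1 h1 a2 b2 d a3 b3

end runner

/-! ### Addable and removable boxes in terms of beads -/

theorem res_eq_iff {ℓ i : ℕ} (hi : i < ℓ) (p : ℕ × ℕ) :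
    res ℓ p = i ↔ (ℓ : ℤ) ∣ (p.2 : ℤ) - p.1 - i := by
  unfold res
  have h0 : 0 ≤ ((p.2 : ℤ) - (p.1 : ℤ)) % (ℓ : ℤ) := Int.emod_nonneg _ (by omega)
  have hii : (i : ℤ) % ℓ = i := Int.emod_eq_of_lt (by omega) (by omega)
  have h1 : ((((p.2 : ℤ) - (p.1 : ℤ)) % (ℓ : ℤ)).toNat = i) ↔
      ((p.2 : ℤ) - (p.1 : ℤ)) % (ℓ : ℤ) = i := by omega
  rw [h1]
  constructor
  · intro h
    apply Int.dvd_of_emod_eq_zero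
    rw [Int.sub_emod, hii, h]
    simp
  · intro h
    have h3 := Int.emod_eq_emod_iff_emod_sub_eq_zero.2 (Int.emod_eq_zero_of_dvd h)
    rw [h3, hii]

theorem addable_iff (μ : YPartition) {a : ℕ} (ha : 1 ≤ a) :
    Addable μ (a, μ.part a + 1) ↔ beta μ a + 1 ∉ bd μ := by
  constructor
  · rintro ⟨-, -, h⟩ ⟨c, hc, hb⟩
    have hca : c < a := (beta_le_iff μ hc ha).1 (by omega)
    simp only at h
    rcases h with h | h
    · omega
    · have h1 := μ.antitone c (a - 1) hc (by omega)
      unfold beta at hb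
      omega
  · intro h
    refine ⟨ha, rfl, ?_⟩
    by_contra hn
    push Not at hn
    simp only at hn
    apply h
    refine ⟨a - 1, by omega, ?_⟩
    have := μ.antitone (a - 1) a (by omega) (by omega)
    unfold beta
    omega

theorem removable_iff (μ : YPartition) {a : ℕ} (ha : 1 ≤ a) :
    Removable μ (a, μ.part a) ↔ beta μ a - 1 ∉ bd μ := by
  constructor
  · rintro ⟨-, -, h⟩ ⟨c, hc, hb⟩
    have hca : a < c := (beta_le_iff μ ha hc).1 (by omega)
    simp only at h
    have h1 := μ.antitone (a + 1) c (by omega) (by omega)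
    unfold beta at hb
    omega
  · intro h
    refine ⟨ha, rfl, ?_⟩
    by_contra hn
    simp only at hn
    apply h
    refine ⟨a + 1, by omega, ?_⟩
    have := μ.antitone a (a + 1) (by omega) (by omega)
    unfold beta
    omega

theorem mem_addRes {ℓ i : ℕ} (hi : i < ℓ) (μ : YPartition) {a b : ℕ} :
    (a, b) ∈ AddableRes ℓ i μ ↔
      1 ≤ a ∧ b = μ.part a + 1 ∧ beta μ a + 1 ∉ bd μ ∧ (ℓ : ℤ) ∣ beta μ a + 1 - i := by
  constructor
  · rintro ⟨h1, h2⟩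
    have ha := h1.1
    have hb := h1.2.1
    simp only at ha hb
    subst hb
    refine ⟨ha, rfl, (addable_iff μ ha).1 h1, ?_⟩
    rw [res_eq_iff hi] at h2
    unfold beta
    simp only at h2
    push_cast at h2
    ring_nf at h2 ⊢
    exact h2
  · rintro ⟨ha, rfl, h1, h2⟩
    refine ⟨(addable_iff μ ha).2 h1, ?_⟩
    rw [res_eq_iff hi]
    unfold beta at h2
    simp only
    push_cast
    ring_nf at h2 ⊢
    exact h2

theorem mem_remRes {ℓ i : ℕ} (hi : i < ℓ) (μ : YPartition) {a b : ℕ} :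
    (a, b) ∈ RemovableRes ℓ i μ ↔
      1 ≤ a ∧ b = μ.part a ∧ beta μ a - 1 ∉ bd μ ∧ (ℓ : ℤ) ∣ beta μ a - i := by
  constructor
  · rintro ⟨h1, h2⟩
    have ha := h1.1
    have hb := h1.2.1
    simp only at ha hb
    subst hb
    refine ⟨ha, rfl, (removable_iff μ ha).1 h1, ?_⟩
    rw [res_eq_iff hi] at h2
    exact h2
  · rintro ⟨ha, rfl, h1, h2⟩
    refine ⟨(removable_iff μ ha).2 h1, ?_⟩
    rw [res_eq_iff hi]
    exact h2

theorem part_eq_of (μ : YPartition) {a k : ℕ} (ha : 1 ≤ a)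
    (h : ∀ b, 1 ≤ b → ((a, b) ∈ μ.cells ↔ b ≤ k)) : μ.part a = k := by
  have h2 : ∀ b, 1 ≤ b → (b ≤ μ.part a ↔ b ≤ k) := by
    intro b hb
    rw [← h b hb]
    exact ⟨fun h => ⟨ha, hb, h⟩, fun h => h.2.2⟩
  rcases Nat.eq_zero_or_pos (μ.part a) with h3 | h3
  · rcases Nat.eq_zero_or_pos k with h4 | h4
    · omega
    · have := (h2 k h4).2 le_rfl; omega
  · have := (h2 _ h3).1 le_rfl
    have := (h2 k (by omega)).2 le_rfl
    omega

theorem mem_cells_iff (μ : YPartition) {a b : ℕ} :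
    (a, b) ∈ μ.cells ↔ 1 ≤ a ∧ 1 ≤ b ∧ b ≤ μ.part a := Iff.rfl

theorem upOf_of_cells {ℓ i : ℕ} (hℓ : 2 < ℓ) (hi : i < ℓ) {lam mu : YPartition}
    (h : mu.cells = lam.cells ∪ AddableRes ℓ i lam) : UpOf ℓ i (bd lam) (bd mu) := by
  have k1 : ∀ a, 1 ≤ a → beta lam a + 1 ∉ bd lam → (ℓ : ℤ) ∣ beta lam a + 1 - i →
      beta mu a = beta lam a + 1 := by
    intro a ha h1 h2
    have : mu.part a = lam.part a + 1 := by
      apply part_eq_of mu ha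
      intro b hb
      rw [h, Set.mem_union, mem_addRes hi, mem_cells_iff]
      constructor
      · rintro (h3 | h3) <;> omega
      · intro h3
        rcases Nat.lt_or_ge (lam.part a) b with h4 | h4
        · exact Or.inr ⟨ha, by omega, h1, h2⟩
        · exact Or.inl ⟨ha, hb, h4⟩
    unfold beta
    omega
  have k2 : ∀ a, 1 ≤ a → ¬ (beta lam a + 1 ∉ bd lam ∧ (ℓ : ℤ) ∣ beta lam a + 1 - i) →
      beta mu a = beta lam a := by
    intro a ha h1
    have : mu.part a = lam.part a := by
      apply part_eq_of mu ha
      intro b hb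
      rw [h, Set.mem_union, mem_addRes hi, mem_cells_iff]
      constructor
      · rintro (h3 | h3)
        · omega
        · exact absurd h3.2.2 h1
      · intro h3
        exact Or.inl ⟨ha, hb, h3⟩
    unfold beta
    omega
  have k3 : ∀ z, z ∈ bd mu → (z ∈ bd lam ∧ ¬ (z + 1 ∉ bd lam ∧ (ℓ : ℤ) ∣ z + 1 - i)) ∨
      (z - 1 ∈ bd lam ∧ (ℓ : ℤ) ∣ z - i) := by
    rintro z ⟨a, ha, rfl⟩
    by_cases hc : beta lam a + 1 ∉ bd lam ∧ (ℓ : ℤ) ∣ beta lam a + 1 - i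
    · rw [k1 a ha hc.1 hc.2]
      exact Or.inr ⟨⟨a, ha, by ring⟩, hc.2⟩
    · rw [k2 a ha hc]
      exact Or.inl ⟨⟨a, ha, rfl⟩, hc⟩
  have k4 : ∀ z, z ∈ bd lam → ¬ (z + 1 ∉ bd lam ∧ (ℓ : ℤ) ∣ z + 1 - i) → z ∈ bd mu := by
    rintro z ⟨a, ha, rfl⟩ hc
    exact ⟨a, ha, k2 a ha hc⟩
  refine ⟨fun z hz => ⟨fun hm => ?_, fun hm => ?_⟩, fun z hz => ⟨fun hm => ?_, fun hm => ?_⟩,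
    fun z hz hz' => ⟨fun hm => ?_, fun hm => ?_⟩⟩
  · rcases k3 z hm with h1 | h1
    · exact Or.inl h1.1
    · exact Or.inr h1.1
  · by_cases hB : z ∈ bd lam
    · exact k4 z hB fun hh => (cC hℓ hz).1 hh.2
    · rcases hm with hm | ⟨a, ha, hm⟩
      · exact absurd hm hB
      · refine ⟨a, ha, ?_⟩
        have e : beta lam a + 1 = z := by omega
        rw [k1 a ha (by rw [e]; exact hB) (by rw [e]; exact hz), e]
  · rcases k3 z hm with h1 | h1
    · refine ⟨h1.1, ?_⟩
      by_contra h2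
      exact h1.2 ⟨h2, hz⟩
    · exact absurd hz (cC hℓ h1.2).1
  · exact k4 z hm.1 fun hh => hh.1 hm.2
  · rcases k3 z hm with h1 | h1
    · exact h1.1
    · exact absurd h1.2 hz
  · exact k4 z hm fun hh => hz' hh.2

theorem downOf_of_cells {ℓ i : ℕ} (hℓ : 2 < ℓ) (hi : i < ℓ) {lam mu : YPartition}
    (h : mu.cells = lam.cells \ RemovableRes ℓ i lam) : DownOf ℓ i (bd lam) (bd mu) := by
  have k1 : ∀ a, 1 ≤ a → beta lam a - 1 ∉ bd lam → (ℓ : ℤ) ∣ beta lam a - i →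
      beta mu a = beta lam a - 1 := by
    intro a ha h1 h2
    have h0 := ((removable_iff lam ha).2 h1).2.2
    simp only at h0
    have : mu.part a = lam.part a - 1 := by
      apply part_eq_of mu ha
      intro b hb
      rw [h, Set.mem_sdiff, mem_remRes hi, mem_cells_iff]
      constructor
      · rintro ⟨h3, h4⟩
        have : b ≠ lam.part a := fun h5 => h4 ⟨ha, h5, h1, h2⟩
        omega
      · intro h3
        exact ⟨⟨ha, hb, by omega⟩, fun h4 => by omega⟩
    unfold beta
    omega
  have k2 : ∀ a, 1 ≤ a → ¬ (beta lam a - 1 ∉ bd lam ∧ (ℓ : ℤ) ∣ beta lam a - i) →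
      beta mu a = beta lam a := by
    intro a ha h1
    have : mu.part a = lam.part a := by
      apply part_eq_of mu ha
      intro b hb
      rw [h, Set.mem_sdiff, mem_remRes hi, mem_cells_iff]
      constructor
      · rintro ⟨h3, -⟩
        omega
      · intro h3
        exact ⟨⟨ha, hb, h3⟩, fun h4 => h1 h4.2.2⟩
    unfold beta
    omega
  have k3 : ∀ z, z ∈ bd mu → (z ∈ bd lam ∧ ¬ (z - 1 ∉ bd lam ∧ (ℓ : ℤ) ∣ z - i)) ∨
      (z + 1 ∈ bd lam ∧ (ℓ : ℤ) ∣ z + 1 - i) := by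
    rintro z ⟨a, ha, rfl⟩
    by_cases hc : beta lam a - 1 ∉ bd lam ∧ (ℓ : ℤ) ∣ beta lam a - i
    · rw [k1 a ha hc.1 hc.2]
      exact Or.inr ⟨⟨a, ha, by ring⟩, by simpa using hc.2⟩
    · rw [k2 a ha hc]
      exact Or.inl ⟨⟨a, ha, rfl⟩, hc⟩
  have k4 : ∀ z, z ∈ bd lam → ¬ (z - 1 ∉ bd lam ∧ (ℓ : ℤ) ∣ z - i) → z ∈ bd mu := by
    rintro z ⟨a, ha, rfl⟩ hc
    exact ⟨a, ha, k2 a ha hc⟩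
  refine ⟨fun z hz => ⟨fun hm => ?_, fun hm => ?_⟩, fun z hz => ⟨fun hm => ?_, fun hm => ?_⟩,
    fun z hz hz' => ⟨fun hm => ?_, fun hm => ?_⟩⟩
  · rcases k3 z hm with h1 | h1
    · refine ⟨h1.1, ?_⟩
      by_contra h2
      exact h1.2 ⟨h2, hz⟩
    · exact absurd h1.2 (cC hℓ hz).1
  · exact k4 z hm.1 fun hh => hh.1 hm.2
  · rcases k3 z hm with h1 | h1
    · exact Or.inl h1.1
    · exact Or.inr h1.1
  · by_cases hB : z ∈ bd lam
    · exact k4 z hB fun hh => (cC hℓ hh.2).1 hz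
    · rcases hm with hm | ⟨a, ha, hm⟩
      · exact absurd hm hB
      · refine ⟨a, ha, ?_⟩
        have e : beta lam a - 1 = z := by omega
        rw [k1 a ha (by rw [e]; exact hB) (by rw [hm]; exact hz), e]
  · rcases k3 z hm with h1 | h1
    · exact h1.1
    · exact absurd h1.2 hz'
  · exact k4 z hm fun hh => hz hh.2

/-! ### In a JM partition every addable `i`-box precedes every removable `i`-box -/

/-- All addable `i`-boxes strictly precede all removable `i`-boxes in the ladder order. -/
def LadSep (ℓ i : ℕ) (μ : YPartition) : Prop :=
  ∀ p ∈ AddableRes ℓ i μ, ∀ q ∈ RemovableRes ℓ i μ, LadderLT ℓ p q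

theorem count_beads {ℓ : ℕ} (hℓ : 2 < ℓ) (μ : YPartition) {a c n : ℕ} {y : ℤ} (ha : 1 ≤ a)
    (hx : beta μ a = y + ℓ * n) (hc : 1 ≤ c) (hy : beta μ c = y + 1)
    (hall : ∀ z, z ∉ bd μ → z < y + ℓ * n → (ℓ : ℤ) ∣ z - y) :
    (ℓ - 1) * n ≤ c - a := by
  have hcard : ((Finset.range n) ×ˢ (Finset.Ico 1 ℓ)).card ≤
      ((Finset.Ioc a c).image (beta μ)).card := by
    apply Finset.card_le_card_of_injOn (fun jr => y + ℓ * jr.1 + jr.2)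
    · rintro ⟨j, r⟩ hjr
      simp only [Finset.coe_product, Set.mem_prod, Finset.mem_coe, Finset.mem_range,
        Finset.mem_Ico] at hjr
      obtain ⟨hj, hr1, hr2⟩ := hjr
      have hub : (ℓ : ℤ) * j + ℓ ≤ ℓ * n := by
        have : (j : ℤ) + 1 ≤ n := by omega
        nlinarith
      have hlb : (0 : ℤ) ≤ ℓ * j := by positivity
      have hz : y + ℓ * j + r ∈ bd μ := by
        by_contra hz
        have h1 := hall _ hz (by omega)
        have h2 : (ℓ : ℤ) ∣ r := by
          have h3 : (ℓ : ℤ) ∣ ℓ * j := dvd_mul_right _ _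
          have h4 := dvd_sub h1 h3
          have e : y + ℓ * j + r - y - ℓ * j = (r : ℤ) := by ring
          rwa [e] at h4
        have := Int.le_of_dvd (by omega) h2
        omega
      obtain ⟨t, ht, hbt⟩ := hz
      simp only [Finset.coe_image, Set.mem_image, Finset.mem_coe, Finset.mem_Ioc]
      refine ⟨t, ⟨?_, ?_⟩, hbt⟩
      · apply (beta_le_iff μ ha ht).1
        omega
      · by_contra hlt
        have := beta_lt μ hc (c := t) (by omega)
        omega
    · rintro ⟨j, r⟩ hjr ⟨j', r'⟩ hjr' he
      simp only [Finset.coe_product, Set.mem_prod, Finset.mem_coe, Finset.mem_range,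
        Finset.mem_Ico] at hjr hjr'
      simp only at he
      have h1 : ℓ * j + r = ℓ * j' + r' := by
        have : (ℓ : ℤ) * j + r = ℓ * j' + r' := by linarith
        exact_mod_cast this
      have hr : r = r' := by
        have h2 : (ℓ * j + r) % ℓ = (ℓ * j' + r') % ℓ := by rw [h1]
        rwa [Nat.mul_add_mod, Nat.mul_add_mod, Nat.mod_eq_of_lt hjr.2.2,
          Nat.mod_eq_of_lt hjr'.2.2] at h2
      subst hr
      have hj : ℓ * j = ℓ * j' := by omega
      have := Nat.eq_of_mul_eq_mul_left (by omega) hj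
      subst this
      rfl
  have h2 := hcard.trans Finset.card_image_le
  simp only [Finset.card_product, Finset.card_range, Nat.card_Ico, Nat.card_Ioc] at h2
  rw [mul_comm]
  exact h2

theorem spread_beads {ℓ : ℕ} (μ : YPartition) {a c n : ℕ} {x : ℤ} (hca : c < a)
    (hx : beta μ a = x) (hc : 1 ≤ c) (hy : beta μ c = x + 1 + ℓ * n) (hn : 1 ≤ n)
    (hx1 : x + 1 ∉ bd μ)
    (hall : ∀ z, z ∈ bd μ → x + 1 < z → (ℓ : ℤ) ∣ z - (x + 1)) : a - c ≤ n := by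
  have hdv : ∀ t, 1 ≤ t → t < a → (ℓ : ℤ) ∣ beta μ t - (x + 1) ∧ x + 1 < beta μ t := by
    intro t ht hta
    have h1 := beta_lt μ ht hta
    have h2 : beta μ t ≠ x + 1 := fun h => hx1 ⟨t, ht, h⟩
    have h3 : x + 1 < beta μ t := by omega
    exact ⟨hall _ ⟨t, ht, rfl⟩ h3, h3⟩
  have key : ∀ k : ℕ, c + k < a → beta μ (c + k) + ℓ * k ≤ x + 1 + ℓ * n := by
    intro k
    induction k with
    | zero => intro _; simp [hy]
    | succ k ih =>
      intro hk
      have h1 := ih (by omega)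
      have h2 := hdv (c + k) (by omega) (by omega)
      have h3 := hdv (c + (k + 1)) (by omega) hk
      have h4 := beta_lt μ (a := c + k) (c := c + (k + 1)) (by omega) (by omega)
      have h5 : (ℓ : ℤ) ∣ beta μ (c + k) - beta μ (c + (k + 1)) := by
        have := dvd_sub h2.1 h3.1
        ring_nf at this ⊢; exact this
      have h6 := dv_le h5 h4
      push_cast
      linarith
  have hk := key (a - c - 1) (by omega)
  have h1 := hdv (c + (a - c - 1)) (by omega) (by omega)
  have h2 := dv_le h1.1 h1.2
  have hℓ : (0 : ℤ) < ℓ := by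
    rcases Nat.eq_zero_or_pos ℓ with h0 | h0
    · subst h0
      have := h1.1
      simp at this
      have h3 := h1.2
      omega
    · exact_mod_cast h0
  have h3 : (ℓ : ℤ) * (1 + ((a - c - 1 : ℕ) : ℤ)) ≤ ℓ * n := by linarith
  have h4 := le_of_mul_le_mul_left h3 hℓ
  omega

theorem sep_of_JM {ℓ i : ℕ} (hℓ : 2 < ℓ) (hi : i < ℓ) {μ : YPartition}
    (h : JMB ℓ (bd μ)) : LadSep ℓ i μ := by
  rintro ⟨a, b⟩ hp ⟨c, d⟩ hq
  rw [mem_addRes hi] at hp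
  rw [mem_remRes hi] at hq
  obtain ⟨ha, rfl, hx1, hxd⟩ := hp
  obtain ⟨hc, rfl, hy, hyd⟩ := hq
  have hcpos := ((removable_iff μ hc).2 hy).2.2
  simp only at hcpos
  obtain ⟨L, rfl⟩ : ∃ L, ℓ = L + 1 := ⟨ℓ - 1, by omega⟩
  have eI : ∀ r s : ℕ, ladderIdx (L + 1) (r, s) = r + L * (s - 1) := by
    intro r s; simp [ladderIdx]
  unfold LadderLT
  rw [eI, eI]
  simp only [Nat.add_sub_cancel]
  obtain ⟨D, hD⟩ : ∃ D, μ.part c = D + 1 := ⟨μ.part c - 1, by omega⟩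
  rw [hD, Nat.add_sub_cancel]
  set y : ℤ := beta μ c - 1 with hydef
  have hyc : beta μ c = y + 1 := by omega
  have hb1 : (μ.part a : ℤ) = beta μ a + a := by unfold beta; ring
  have hb2 : (D : ℤ) = y + c := by rw [hydef]; unfold beta; omega
  have dxy : ((L + 1 : ℕ) : ℤ) ∣ beta μ a - y := by
    have := dvd_sub hxd hyd
    rw [hyc] at this
    ring_nf at this ⊢; exact this
  have hLp : (2 : ℤ) ≤ L := by omega
  rcases lt_trichotomy y (beta μ a) with hlt | heq | hgt
  · obtain ⟨n', hn'⟩ := dxy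
    have hn0 : 0 < n' := by
      by_contra hneg
      push Not at hneg
      have : ((L + 1 : ℕ) : ℤ) * n' ≤ 0 := mul_nonpos_of_nonneg_of_nonpos (by omega) hneg
      omega
    obtain ⟨n, rfl⟩ : ∃ n : ℕ, n' = n := ⟨n'.toNat, by omega⟩
    have hx : beta μ a = y + ((L + 1 : ℕ) : ℤ) * n := by omega
    have hcount := count_beads hℓ μ ha hx hc hyc (by
      intro z hz hzlt
      rcases h (beta μ a) y z (y + 1) ⟨a, ha, rfl⟩ hy hz ⟨c, hc, hyc⟩ hlt (by omega)
        (by omega) ⟨n, by omega⟩ with h1 | h1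
      · have h2 : ((L + 1 : ℕ) : ℤ) ∣ beta μ a - y := ⟨n, by omega⟩
        have h3 := dvd_sub h2 h1
        rwa [sub_sub_sub_cancel_left] at h3
      · exact absurd h1 (cE hℓ).2.2.1)
    simp only [Nat.add_sub_cancel] at hcount
    have hac : a < c := by
      have : 0 < L * n := by
        apply Nat.mul_pos <;> omega
      omega
    have hcz : (L : ℤ) * n ≤ c - a := by
      have : ((L * n : ℕ) : ℤ) ≤ ((c - a : ℕ) : ℤ) := by exact_mod_cast hcount
      push_cast [Nat.cast_sub hac.le] at this
      exact this
    have hle : a + L * μ.part a ≤ c + L * D := by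
      zify
      rw [hb1, hb2, hx]
      push_cast
      nlinarith
    omega
  · exfalso
    apply hy
    exact ⟨a, ha, heq.symm⟩
  · have dyx : ((L + 1 : ℕ) : ℤ) ∣ y - beta μ a := by
      have := (dvd_neg).2 dxy
      rwa [neg_sub] at this
    obtain ⟨n', hn'⟩ := dyx
    have hn0 : 0 < n' := by
      by_contra hneg
      push Not at hneg
      have : ((L + 1 : ℕ) : ℤ) * n' ≤ 0 := mul_nonpos_of_nonneg_of_nonpos (by omega) hneg
      omega
    obtain ⟨n, rfl⟩ : ∃ n : ℕ, n' = n := ⟨n'.toNat, by omega⟩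
    have hca : c < a := (beta_le_iff μ hc ha).1 (by omega)
    have hk := spread_beads (ℓ := L + 1) μ hca rfl hc (n := n) (by omega) (by omega) hx1 (by
      intro z hz hzlt
      have e : ((L + 1 : ℕ) : ℤ) ∣ y + 1 - (beta μ a + 1) := ⟨n, by omega⟩
      rcases h (y + 1) (beta μ a + 1) y z ⟨c, hc, hyc⟩ hx1 hy hz (by omega) (by omega)
        hzlt e with h1 | h1
      · exact absurd h1 (cE hℓ).2.2.1
      · exact h1)
    left
    have hkz : (a : ℤ) - c ≤ n := by omega
    have hyx : y = beta μ a + (L + 1) * n := by push_cast at hn'; linarith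
    zify
    rw [hb1, hb2, hyx]
    have hn1 : (1 : ℤ) ≤ n := by omega
    have e1 : ((a : ℤ) - c) * (L + 1) ≤ n * (L + 1) :=
      mul_le_mul_of_nonneg_right hkz (by omega)
    have e2 : (n : ℤ) * (L + 1) * 2 ≤ n * (L + 1) * L :=
      mul_le_mul_of_nonneg_left hLp (by positivity)
    have e3 : (0 : ℤ) < n * (L + 1) := by positivity
    nlinarith

/-! ### Iterating the operators -/

theorem addRes_finite (ℓ i : ℕ) (μ : YPartition) : (AddableRes ℓ i μ).Finite := by
  obtain ⟨N, hN⟩ := μ.eventually_zero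
  apply ((Set.finite_Iic (N + 1)).image fun a => (a, μ.part a + 1)).subset
  rintro ⟨a, b⟩ ⟨⟨h1, h2, h3⟩, -⟩
  simp only at h1 h2 h3
  refine ⟨a, ?_, by simp [h2]⟩
  simp only [Set.mem_Iic]
  by_contra hlt
  have := hN (a - 1) (by omega)
  omega

theorem remRes_finite (ℓ i : ℕ) (μ : YPartition) : (RemovableRes ℓ i μ).Finite := by
  obtain ⟨N, hN⟩ := μ.eventually_zero
  apply ((Set.finite_Iic N).image fun a => (a, μ.part a)).subset
  rintro ⟨a, b⟩ ⟨⟨h1, h2, h3⟩, -⟩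
  simp only at h1 h2 h3
  refine ⟨a, ?_, by simp [h2]⟩
  simp only [Set.mem_Iic]
  by_contra hlt
  have := hN a (by omega)
  omega

/-- Parts after inserting an addable box. -/
theorem part_insert {ν ν' : YPartition} {p : ℕ × ℕ} (hp : Addable ν p)
    (h : ν'.cells = insert p ν.cells) :
    ν'.part p.1 = ν.part p.1 + 1 ∧ ∀ a, a ≠ p.1 → ν'.part a = ν.part a := by
  obtain ⟨r, s⟩ := p
  obtain ⟨h1, h2, h3⟩ := hp
  simp only at h1 h2 h3 ⊢
  subst h2
  constructor
  · apply part_eq_of _ h1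
    intro b hb
    rw [h, Set.mem_insert_iff, mem_cells_iff, Prod.mk.injEq]
    omega
  · intro a ha
    rcases Nat.eq_zero_or_pos a with h0 | h0
    · subst h0
      rw [ν.zero_at_zero, ν'.zero_at_zero]
    · apply part_eq_of _ h0
      intro b hb
      rw [h, Set.mem_insert_iff, mem_cells_iff, Prod.mk.injEq]
      omega

theorem res_shift {ℓ i : ℕ} (hℓ : 2 < ℓ) (hi : i < ℓ) {p q : ℕ × ℕ} (hp : res ℓ p = i)
    (hq : res ℓ q = i) : (p.2 : ℤ) - p.1 - (q.2 - q.1) ≠ 1 ∧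
      (p.2 : ℤ) - p.1 - (q.2 - q.1) ≠ -1 := by
  rw [res_eq_iff hi] at hp hq
  have := dv_one hℓ hp hq
  omega

theorem step {ℓ i : ℕ} (hℓ : 2 < ℓ) (hi : i < ℓ) {ν ν' : YPartition} {p : ℕ × ℕ}
    (hp : p ∈ AddableRes ℓ i ν) (h : ν'.cells = insert p ν.cells) :
    AddableRes ℓ i ν' = AddableRes ℓ i ν \ {p} ∧
    RemovableRes ℓ i ν' = insert p (RemovableRes ℓ i ν) := by
  obtain ⟨k1, k2⟩ := part_insert hp.1 h
  obtain ⟨r, s⟩ := p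
  obtain ⟨⟨h1, h2, h3⟩, hr⟩ := hp
  simp only at h1 h2 h3 k1 k2
  constructor
  · ext ⟨a, b⟩
    simp only [Set.mem_sdiff, Set.mem_singleton_iff, Prod.mk.injEq]
    constructor
    · rintro ⟨⟨g1, g2, g3⟩, g4⟩
      have hs := res_shift hℓ hi hr g4
      simp only at g1 g2 g3 hs
      have hne : a ≠ r := by
        rintro rfl
        omega
      refine ⟨⟨⟨g1, ?_, ?_⟩, g4⟩, fun hh => hne hh.1⟩
      · simp only
        rw [g2, k2 a hne]
      · simp only
        rcases g3 with g3 | g3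
        · exact Or.inl g3
        · right
          by_cases e : a - 1 = r
          · rw [e, k1] at g3
            rw [e]
            omega
          · rw [k2 _ e] at g3
            exact g3
    · rintro ⟨⟨⟨g1, g2, g3⟩, g4⟩, g5⟩
      simp only at g1 g2 g3
      have hne : a ≠ r := by
        rintro rfl
        exact g5 ⟨rfl, by omega⟩
      refine ⟨⟨g1, ?_, ?_⟩, g4⟩
      · simp only
        rw [g2, k2 a hne]
      · simp only
        rcases g3 with g3 | g3
        · exact Or.inl g3
        · right
          by_cases e : a - 1 = r
          · rw [e, k1]
            rw [e] at g3
            omega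
          · rw [k2 _ e]
            exact g3
  · ext ⟨a, b⟩
    simp only [Set.mem_insert_iff, Prod.mk.injEq]
    constructor
    · rintro ⟨⟨g1, g2, g3⟩, g4⟩
      simp only at g1 g2 g3
      by_cases hne : a = r
      · subst hne
        exact Or.inl ⟨rfl, by omega⟩
      · right
        refine ⟨⟨g1, ?_, ?_⟩, g4⟩
        · simp only
          rw [g2, k2 a hne]
        · simp only
          by_cases e : a + 1 = r
          · rw [e, k1] at g3
            rw [e]
            omega
          · rw [k2 _ e] at g3
            exact g3
    · rintro (⟨rfl, rfl⟩ | ⟨⟨g1, g2, g3⟩, g4⟩)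
      · refine ⟨⟨h1, ?_, ?_⟩, hr⟩
        · simp only
          omega
        · simp only
          rw [k2 _ (by omega)]
          have := ν.antitone a (a + 1) h1 (by omega)
          omega
      · have hs := res_shift hℓ hi hr g4
        simp only at g1 g2 g3 hs
        have hne : a ≠ r := by
          rintro rfl
          omega
        refine ⟨⟨g1, ?_, ?_⟩, g4⟩
        · simp only
          rw [g2, k2 a hne]
        · simp only
          by_cases e : a + 1 = r
          · rw [e, k1]
            rw [e] at g3
            subst e
            push_cast at hs
            omega
          · rw [k2 _ e]
            exact g3

theorem exists_insert {ν : YPartition} {p : ℕ × ℕ} (hp : Addable ν p) :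
    ∃ ν' : YPartition, ν'.cells = insert p ν.cells := by
  obtain ⟨r, s⟩ := p
  obtain ⟨h1, h2, h3⟩ := hp
  simp only at h1 h2 h3
  subst h2
  refine ⟨⟨fun a => if a = r then ν.part r + 1 else ν.part a, ?_, ?_, ?_⟩, ?_⟩
  · try dsimp only
    rw [if_neg (by omega)]
    exact ν.zero_at_zero
  · intro a c ha hac
    try dsimp only
    have h4 := ν.antitone a c ha hac
    by_cases e1 : c = r
    · by_cases e2 : a = r
      · rw [if_pos e1, if_pos e2]
      · rw [if_pos e1, if_neg e2]
        rcases h3 with h3 | h3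
        · omega
        · have := ν.antitone a (r - 1) ha (by omega)
          omega
    · by_cases e2 : a = r
      · rw [if_neg e1, if_pos e2]
        subst e2
        omega
      · rw [if_neg e1, if_neg e2]
        exact h4
  · obtain ⟨N, hN⟩ := ν.eventually_zero
    refine ⟨max N (r + 1), fun a ha => ?_⟩
    try dsimp only
    rw [if_neg (by omega)]
    exact hN a (by omega)
  · ext ⟨a, b⟩
    rw [Set.mem_insert_iff, mem_cells_iff, mem_cells_iff, Prod.mk.injEq]
    try dsimp only
    by_cases e : a = r
    · rw [if_pos e]
      subst e
      omega
    · rw [if_neg e]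
      omega

theorem exists_remove {ν : YPartition} {p : ℕ × ℕ} (hp : Removable ν p) :
    ∃ ν' : YPartition, ν'.cells = ν.cells \ {p} ∧ Addable ν' p := by
  obtain ⟨r, s⟩ := p
  obtain ⟨h1, h2, h3⟩ := hp
  simp only at h1 h2 h3
  subst h2
  refine ⟨⟨fun a => if a = r then ν.part r - 1 else ν.part a, ?_, ?_, ?_⟩, ?_, ?_⟩
  · try dsimp only
    rw [if_neg (by omega)]
    exact ν.zero_at_zero
  · intro a c ha hac
    try dsimp only
    have h4 := ν.antitone a c ha hac
    by_cases e1 : c = r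
    · by_cases e2 : a = r
      · rw [if_pos e1, if_pos e2]
      · rw [if_pos e1, if_neg e2]
        subst e1
        omega
    · by_cases e2 : a = r
      · rw [if_neg e1, if_pos e2]
        have := ν.antitone (r + 1) c (by omega) (by omega)
        omega
      · rw [if_neg e1, if_neg e2]
        exact h4
  · obtain ⟨N, hN⟩ := ν.eventually_zero
    refine ⟨max N (r + 1), fun a ha => ?_⟩
    try dsimp only
    rw [if_neg (by omega)]
    exact hN a (by omega)
  · ext ⟨a, b⟩
    rw [Set.mem_sdiff, Set.mem_singleton_iff, mem_cells_iff, mem_cells_iff, Prod.mk.injEq]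
    try dsimp only
    by_cases e : a = r
    · rw [if_pos e]
      subst e
      omega
    · rw [if_neg e]
      omega
  · refine ⟨h1, ?_, ?_⟩
    · try dsimp only
      simp only [if_true]
      omega
    · try dsimp only
      by_cases e : r = 1
      · exact Or.inl e
      · right
        rw [if_neg (by omega)]
        exact ν.antitone (r - 1) r (by omega) (by omega)

/-- Lexicographic key of the ladder reading order. -/
def lkey (ℓ : ℕ) (p : ℕ × ℕ) : ℕ ×ₗ ℕ := toLex (ladderIdx ℓ p, p.1)

theorem ladderLE_iff (ℓ : ℕ) (p q : ℕ × ℕ) : LadderLE ℓ p q ↔ lkey ℓ p ≤ lkey ℓ q := by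
  unfold LadderLE lkey
  rw [Prod.Lex.toLex_le_toLex]

theorem ladderLT_iff (ℓ : ℕ) (p q : ℕ × ℕ) : LadderLT ℓ p q ↔ lkey ℓ p < lkey ℓ q := by
  unfold LadderLT lkey
  rw [Prod.Lex.toLex_lt_toLex]

theorem LadSep.conormal_iff {ℓ i : ℕ} {ν : YPartition} (h : LadSep ℓ i ν) (q : ℕ × ℕ) :
    LadderConormal ℓ i ν q ↔ q ∈ AddableRes ℓ i ν := by
  refine ⟨fun hq => hq.1, fun hq => ⟨hq, fun p _ hpq => ?_⟩⟩
  have e : RemovableRes ℓ i ν ∩ {s | LadderLE ℓ p s ∧ LadderLE ℓ s q} = ∅ := by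
    rw [Set.eq_empty_iff_forall_notMem]
    rintro s ⟨hs, -, hs2⟩
    have := (ladderLT_iff ..).1 (h q hq s hs)
    exact absurd ((ladderLE_iff ..).1 hs2) (not_le.2 this)
  rw [e, Set.ncard_empty, Set.ncard_pos ((addRes_finite ℓ i ν).inter_of_left _)]
  exact ⟨q, hq, hpq, (ladderLE_iff ..).2 le_rfl⟩

theorem LadSep.normal_iff {ℓ i : ℕ} {ν : YPartition} (h : LadSep ℓ i ν) (q : ℕ × ℕ) :
    LadderNormal ℓ i ν q ↔ q ∈ RemovableRes ℓ i ν := by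
  refine ⟨fun hq => hq.1, fun hq => ⟨hq, fun p _ hpq => ?_⟩⟩
  have e : AddableRes ℓ i ν ∩ {s | LadderLE ℓ q s ∧ LadderLE ℓ s p} = ∅ := by
    rw [Set.eq_empty_iff_forall_notMem]
    rintro s ⟨hs, hs2, -⟩
    have := (ladderLT_iff ..).1 (h s hs q hq)
    exact absurd ((ladderLE_iff ..).1 hs2) (not_le.2 this)
  rw [e, Set.ncard_empty, Set.ncard_pos ((remRes_finite ℓ i ν).inter_of_left _)]
  exact ⟨q, hq, (ladderLE_iff ..).2 le_rfl, hpq⟩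

theorem addRes_row {ℓ i : ℕ} {ν : YPartition} {p q : ℕ × ℕ} (hp : p ∈ AddableRes ℓ i ν)
    (hq : q ∈ AddableRes ℓ i ν) (h : lkey ℓ p = lkey ℓ q) : p = q := by
  have h1 : p.1 = q.1 := congrArg (fun z => (ofLex z).2) h
  have h2 := hp.1.2.1
  have h3 := hq.1.2.1
  rw [h1] at h2
  exact Prod.ext h1 (h2.trans h3.symm)

theorem remRes_row {ℓ i : ℕ} {ν : YPartition} {p q : ℕ × ℕ} (hp : p ∈ RemovableRes ℓ i ν)
    (hq : q ∈ RemovableRes ℓ i ν) (h : lkey ℓ p = lkey ℓ q) : p = q := by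
  have h1 : p.1 = q.1 := congrArg (fun z => (ofLex z).2) h
  have h2 := hp.1.2.1
  have h3 := hq.1.2.1
  rw [h1] at h2
  exact Prod.ext h1 (h2.trans h3.symm)

theorem iterF {ℓ i : ℕ} (hℓ : 2 < ℓ) (hi : i < ℓ) (n : ℕ) : ∀ ν : YPartition,
    (AddableRes ℓ i ν).ncard = n → LadSep ℓ i ν →
    ∃ mu : YPartition, RelIter (HatF ℓ i) n ν mu ∧ mu.cells = ν.cells ∪ AddableRes ℓ i ν := by
  induction n with
  | zero =>
    intro ν hn _
    rw [Set.ncard_eq_zero (addRes_finite ℓ i ν)] at hn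
    exact ⟨ν, rfl, by rw [hn, Set.union_empty]⟩
  | succ n ih =>
    intro ν hn hs
    have hfin := addRes_finite ℓ i ν
    have hne : (AddableRes ℓ i ν).Nonempty := by
      rw [← Set.ncard_pos hfin]; omega
    obtain ⟨p, hp, hmax⟩ := Set.exists_max_image _ (lkey ℓ) hfin hne
    obtain ⟨ν', hν'⟩ := exists_insert hp.1
    obtain ⟨eA, eR⟩ := step hℓ hi hp hν'
    have hs' : LadSep ℓ i ν' := by
      intro q hq r hr
      rw [eA] at hq
      rw [eR] at hr
      rcases hr with rfl | hr
      · rw [ladderLT_iff]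
        exact lt_of_le_of_ne (hmax q hq.1) fun e => hq.2 (addRes_row hq.1 hp e)
      · exact hs q hq.1 r hr
    have hn' : (AddableRes ℓ i ν').ncard = n := by
      rw [eA, Set.ncard_sdiff_singleton_of_mem hp, hn]
      rfl
    obtain ⟨mu, h1, h2⟩ := ih ν' hn' hs'
    refine ⟨mu, ⟨ν', ⟨p, ⟨(hs.conormal_iff p).2 hp, fun q hq => ?_⟩, hν'⟩, h1⟩, ?_⟩
    · rw [ladderLE_iff]
      exact hmax q ((hs.conormal_iff q).1 hq)
    · rw [h2, hν', eA]
      ext q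
      simp only [Set.mem_union, Set.mem_insert_iff, Set.mem_sdiff, Set.mem_singleton_iff]
      by_cases e : q = p
      · subst e; simp [hp]
      · simp [e]

theorem iterE {ℓ i : ℕ} (hℓ : 2 < ℓ) (hi : i < ℓ) (n : ℕ) : ∀ ν : YPartition,
    (RemovableRes ℓ i ν).ncard = n → LadSep ℓ i ν →
    ∃ mu : YPartition, RelIter (HatE ℓ i) n ν mu ∧ mu.cells = ν.cells \ RemovableRes ℓ i ν := by
  induction n with
  | zero =>
    intro ν hn _
    rw [Set.ncard_eq_zero (remRes_finite ℓ i ν)] at hn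
    exact ⟨ν, rfl, by rw [hn, Set.sdiff_empty]⟩
  | succ n ih =>
    intro ν hn hs
    have hfin := remRes_finite ℓ i ν
    have hne : (RemovableRes ℓ i ν).Nonempty := by
      rw [← Set.ncard_pos hfin]; omega
    obtain ⟨p, hp, hmin⟩ := Set.exists_min_image _ (lkey ℓ) hfin hne
    obtain ⟨ν', hν', hadd⟩ := exists_remove hp.1
    have hpc : p ∈ ν.cells := by
      obtain ⟨h1, h2, h3⟩ := hp.1
      exact ⟨h1, by omega, h2.le⟩
    have hpA : p ∈ AddableRes ℓ i ν' := ⟨hadd, hp.2⟩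
    obtain ⟨eA, eR⟩ := step (ν := ν') (ν' := ν) hℓ hi hpA (by
      rw [hν', Set.insert_sdiff_singleton, Set.insert_eq_of_mem hpc])
    have hpR : p ∉ RemovableRes ℓ i ν' := by
      intro hh
      have h1 := hh.1.2.1
      have h2 := hadd.2.1
      omega
    have hs' : LadSep ℓ i ν' := by
      intro q hq r hr
      have hr' : r ∈ RemovableRes ℓ i ν := by rw [eR]; exact Or.inr hr
      by_cases e : q = p
      · subst e
        rw [ladderLT_iff]
        exact lt_of_le_of_ne (hmin r hr') fun e => hpR (by rw [remRes_row hp hr' e]; exact hr)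
      · exact hs q (by rw [eA]; exact ⟨hq, e⟩) r hr'
    have hn' : (RemovableRes ℓ i ν').ncard = n := by
      rw [eR, Set.ncard_insert_of_notMem hpR (remRes_finite ℓ i ν')] at hn
      omega
    obtain ⟨mu, h1, h2⟩ := ih ν' hn' hs'
    refine ⟨mu, ⟨ν', ⟨p, ⟨(hs.normal_iff p).2 hp, fun q hq => ?_⟩, hν'⟩, h1⟩, ?_⟩
    · rw [ladderLE_iff]
      exact hmin q ((hs.normal_iff q).1 hq)
    · rw [h2, hν', eR]
      ext q
      simp only [Set.mem_insert_iff, Set.mem_sdiff, Set.mem_singleton_iff]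
      tauto

/-- if `λ` is an `(ℓ,0)`-JM partition, then `f̂_i^{φ̂_i(λ)} λ` and
`ê_i^{ε̂_i(λ)} λ` are `(ℓ,0)`-JM partitions. -/
theorem statement13 (ℓ : ℕ) (hℓ : 2 < ℓ) (i : ℕ) (hi : i < ℓ) (lam : YPartition)
    (hJM : IsJM ℓ lam) :
    (∃ mu : YPartition, RelIter (HatF ℓ i) (hatPhi ℓ i lam) lam mu ∧ IsJM ℓ mu) ∧
    (∃ mu : YPartition, RelIter (HatE ℓ i) (hatEps ℓ i lam) lam mu ∧ IsJM ℓ mu) := by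
  have hB := (isJM_iff ℓ lam).1 hJM
  have hs := sep_of_JM hℓ hi hB
  constructor
  · have e : hatPhi ℓ i lam = (AddableRes ℓ i lam).ncard := by
      unfold hatPhi
      congr 1
      ext q
      exact hs.conormal_iff q
    obtain ⟨mu, h1, h2⟩ := iterF hℓ hi _ lam rfl hs
    refine ⟨mu, by rw [e]; exact h1, ?_⟩
    rw [isJM_iff]
    exact hB.up hℓ (upOf_of_cells hℓ hi h2)
  · have e : hatEps ℓ i lam = (RemovableRes ℓ i lam).ncard := by
      unfold hatEps
      congr 1
      ext q
      exact hs.normal_iff q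
    obtain ⟨mu, h1, h2⟩ := iterE hℓ hi _ lam rfl hs
    refine ⟨mu, by rw [e]; exact h1, ?_⟩
    rw [isJM_iff]
    exact hB.down hℓ (downOf_of_cells hℓ hi h2)
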